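/- arXiv:math/0701100 — 2 statements merged into one kernel-verified Lean document; each statement's English description precedes it below -/
import Mathlib

section
/- Let ψ, F : ℝ → ℝ be continuous, let a' < b' and let f : [a',b'] → ℝ be continuous, let a < b be real numbers, and let φ₂, φ₃ : ℝ → ℝ be mollifiers (nonnegative, supported in (−1,1), of integral 1), with φ_j^ε(s) := ε^{−1} φ_j(s/ε). Then the integral I^ε := ∫_{a'}^{b'} ψ(s₁) f(s₁) φ₂^ε(s₁ − a) ( ∫_a^b F(s₃) φ₃^ε(s₁ − s₃) ds₃ ) ds₁ converges, as ε → 0, to ψ(a) F(a) ( A⁻_{2,3} f(a) 1_{a' < a < b'} + B⁻_{2,3} f(a') 1_{a = a'} + C⁻_{2,3} f(b') 1_{a = b'} ), where B⁻_{2,3} := ∫_0^∞ ∫_{−∞}^{y₁} φ₂(y₁) φ₃(y₃) dy₃ dy₁, C⁻_{2,3} := ∫_{−∞}^0 ∫_{−∞}^{y₁} φ₂(y₁) φ₃(y₃) dy₃ dy₁, and A⁻_{2,3} := B⁻_{2,3} + C⁻_{2,3}. -/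
open MeasureTheory Real Set Filter Topology

noncomputable section

/-- A mollifier: nonnegative, supported in `(−1,1)`, of integral `1`. -/
def IsMollifier (φ : ℝ → ℝ) : Prop :=
  Continuous φ ∧ (∀ y, 0 ≤ φ y) ∧
  (∀ y : ℝ, y ∉ Set.Ioo (-1 : ℝ) 1 → φ y = 0) ∧ (∫ y : ℝ, φ y) = 1

/-- `B⁻_{2,3} = ∫_0^∞ ∫_{−∞}^{y₁} φ₂(y₁) φ₃(y₃) dy₃ dy₁`. -/
def Bminus (φ₂ φ₃ : ℝ → ℝ) : ℝ :=
  ∫ y₁ in Set.Ioi (0 : ℝ), ∫ y₃ in Set.Iic y₁, φ₂ y₁ * φ₃ y₃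

/-- `C⁻_{2,3} = ∫_{−∞}^0 ∫_{−∞}^{y₁} φ₂(y₁) φ₃(y₃) dy₃ dy₁`. -/
def Cminus (φ₂ φ₃ : ℝ → ℝ) : ℝ :=
  ∫ y₁ in Set.Iio (0 : ℝ), ∫ y₃ in Set.Iic y₁, φ₂ y₁ * φ₃ y₃

/-- `B⁺_{2,3} = ∫_0^∞ ∫_{y₁}^∞ φ₂(y₁) φ₃(y₃) dy₃ dy₁`. -/
def Bplus (φ₂ φ₃ : ℝ → ℝ) : ℝ :=
  ∫ y₁ in Set.Ioi (0 : ℝ), ∫ y₃ in Set.Ioi y₁, φ₂ y₁ * φ₃ y₃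

/-- `C⁺_{2,3} = ∫_{−∞}^0 ∫_{y₁}^∞ φ₂(y₁) φ₃(y₃) dy₃ dy₁`. -/
def Cplus (φ₂ φ₃ : ℝ → ℝ) : ℝ :=
  ∫ y₁ in Set.Iio (0 : ℝ), ∫ y₃ in Set.Ioi y₁, φ₂ y₁ * φ₃ y₃

theorem integral_comp_add_mul (g : ℝ → ℝ) (x c : ℝ) :
    ∫ y, g (x + c * y) = |c⁻¹| * ∫ s, g s := by
  rw [Measure.integral_comp_mul_left (fun s => g (x + s)) c, smul_eq_mul,
    integral_add_left_eq_self g x]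

theorem exists_abs_indicator_Ioc_le {g : ℝ → ℝ} {p q : ℝ} (hg : ContinuousOn g (Icc p q)) :
    ∃ M, ∀ x, |(Ioc p q).indicator g x| ≤ M := by
  obtain ⟨M, hM⟩ := isCompact_Icc.exists_bound_of_continuousOn hg
  refine ⟨max M 0, fun x => ?_⟩
  by_cases hx : x ∈ Ioc p q
  · rw [indicator_of_mem hx]
    exact (hM x (Ioc_subset_Icc_self hx)).trans (le_max_left _ _)
  · simp [indicator_of_notMem hx]

theorem measurable_indicator_Ioc {g : ℝ → ℝ} {p q : ℝ} (hg : ContinuousOn g (Icc p q)) :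
    Measurable ((Ioc p q).indicator g) := by
  classical
  rw [← piecewise_eq_indicator]
  exact (hg.mono Ioc_subset_Icc_self).measurable_piecewise continuousOn_const measurableSet_Ioc

/-- The limit of a function cut off to an interval, along a ray from `x` with direction `c`. -/
theorem tendsto_indicator_Ioc_ray {g : ℝ → ℝ} {p q : ℝ} (hg : ContinuousOn g (Icc p q))
    (x : ℝ) {c : ℝ} (hc : c ≠ 0) :
    Tendsto (fun ε : ℝ => (Ioc p q).indicator g (x + ε * c)) (𝓝[>] 0)
      (𝓝 (if 0 < c then (if p ≤ x ∧ x < q then g x else 0)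
        else (if p < x ∧ x ≤ q then g x else 0))) := by
  have hlim : Tendsto (fun ε : ℝ => x + ε * c) (𝓝[>] 0) (𝓝 x) := by
    have : Continuous fun ε : ℝ => x + ε * c := by fun_prop
    simpa using (this.tendsto 0).mono_left nhdsWithin_le_nhds
  have hpos : ∀ᶠ ε : ℝ in 𝓝[>] 0, 0 < ε := self_mem_nhdsWithin
  have hin : x ∈ Icc p q → (∀ᶠ ε : ℝ in 𝓝[>] 0, x + ε * c ∈ Ioc p q) →
      Tendsto (fun ε : ℝ => (Ioc p q).indicator g (x + ε * c)) (𝓝[>] 0) (𝓝 (g x)) := by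
    intro hx h
    have h' : Tendsto (fun ε : ℝ => x + ε * c) (𝓝[>] 0) (𝓝[Icc p q] x) :=
      tendsto_nhdsWithin_iff.2 ⟨hlim, h.mono fun _ hε => Ioc_subset_Icc_self hε⟩
    refine ((hg x hx).tendsto.comp h').congr' ?_
    filter_upwards [h] with ε hε
    simp [indicator_of_mem hε]
  have hout : (∀ᶠ ε : ℝ in 𝓝[>] 0, x + ε * c ∉ Ioc p q) →
      Tendsto (fun ε : ℝ => (Ioc p q).indicator g (x + ε * c)) (𝓝[>] 0) (𝓝 0) := by
    intro h
    refine tendsto_const_nhds.congr' ?_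
    filter_upwards [h] with ε hε
    simp [indicator_of_notMem hε]
  rcases hc.lt_or_gt with hc | hc
  · rw [if_neg hc.not_gt]
    split_ifs with hx
    · refine hin ⟨hx.1.le, hx.2⟩ ?_
      filter_upwards [hpos, hlim.eventually_const_lt hx.1] with ε hε h
      exact ⟨h, by nlinarith [hx.2]⟩
    · refine hout ?_
      rcases le_or_gt x p with hxp | hxp
      · filter_upwards [hpos] with ε hε h
        nlinarith [h.1]
      · have hxq : q < x := not_le.1 fun h => hx ⟨hxp, h⟩
        filter_upwards [hlim.eventually_const_lt hxq] with ε hε h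
        exact hε.not_ge h.2
  · rw [if_pos hc]
    split_ifs with hx
    · refine hin ⟨hx.1, hx.2.le⟩ ?_
      filter_upwards [hpos, hlim.eventually_lt_const hx.2] with ε hε h
      exact ⟨by nlinarith [hx.1, mul_pos hε hc], h.le⟩
    · refine hout ?_
      rcases le_or_gt q x with hxq | hxq
      · filter_upwards [hpos] with ε hε h
        nlinarith [h.2, mul_pos hε hc]
      · have hxp : x < p := not_le.1 fun h => hx ⟨h, hxq⟩
        filter_upwards [hlim.eventually_lt_const hxp] with ε hε h
        exact hε.not_gt h.1

theorem IsMollifier.integrable {φ : ℝ → ℝ} (h : IsMollifier φ) : Integrable φ :=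
  Integrable.of_integral_ne_zero (by rw [h.2.2.2]; exact one_ne_zero)

theorem monotone_setIntegral_Iic {φ : ℝ → ℝ} (hφ : Integrable φ) (h0 : ∀ y, 0 ≤ φ y) :
    Monotone fun y => ∫ z in Iic y, φ z := fun _ _ hxy =>
  setIntegral_mono_set hφ.integrableOn (Eventually.of_forall h0)
    (Iic_subset_Iic.2 hxy).eventuallyLE

/-- Rescaling of the convolution of `F` with a mollifier around the endpoint `a`. -/
theorem intervalIntegral_mollifier_eq (F φ : ℝ → ℝ) {a b ε : ℝ} (hab : a ≤ b) (hε : 0 < ε)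
    (y : ℝ) :
    ∫ s in a..b, F s * (ε⁻¹ * φ ((a + ε * y - s) / ε)) =
      ∫ z, (Ioc a b).indicator F (a + ε * (y - z)) * φ z := by
  have key := integral_comp_add_mul
    (fun s => (Ioc a b).indicator F s * φ ((a + ε * y - s) / ε)) (a + ε * y) (-ε)
  rw [abs_inv, abs_neg, abs_of_pos hε, ← integral_const_mul] at key
  rw [intervalIntegral.integral_of_le hab, ← integral_indicator measurableSet_Ioc]
  convert key.symm using 1
  · congr 1 with s
    by_cases hs : s ∈ Ioc a b
    · simp only [indicator_of_mem hs]; ring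
    · simp only [indicator_of_notMem hs]; ring
  · congr 1 with z
    congr 2
    · ring
    · field_simp; ring

theorem abs_integral_indicator_mul_le {F φ : ℝ → ℝ} {a b M : ℝ} (hφ : IsMollifier φ)
    (hM : ∀ x, |(Ioc a b).indicator F x| ≤ M) (ε y : ℝ) :
    |∫ z, (Ioc a b).indicator F (a + ε * (y - z)) * φ z| ≤ M := by
  have h := norm_integral_le_of_norm_le (f := fun z =>
    (Ioc a b).indicator F (a + ε * (y - z)) * φ z) (hφ.integrable.const_mul M)
    (Eventually.of_forall fun z => by
      rw [norm_mul, norm_eq_abs, norm_eq_abs, abs_of_nonneg (hφ.2.1 z)]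
      exact mul_le_mul_of_nonneg_right (hM _) (hφ.2.1 z))
  rwa [integral_const_mul, hφ.2.2.2, mul_one] at h

theorem tendsto_integral_indicator_mul {F φ : ℝ → ℝ} {a b : ℝ} (hab : a < b)
    (hF : ContinuousOn F (Icc a b)) (hφ : IsMollifier φ) (y : ℝ) :
    Tendsto (fun ε : ℝ => ∫ z, (Ioc a b).indicator F (a + ε * (y - z)) * φ z) (𝓝[>] 0)
      (𝓝 (F a * ∫ z in Iic y, φ z)) := by
  obtain ⟨M, hM⟩ := exists_abs_indicator_Ioc_le hF
  have hlim : F a * ∫ z in Iic y, φ z = ∫ z, (Iic y).indicator (fun z => F a * φ z) z := by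
    rw [integral_indicator measurableSet_Iic, integral_const_mul]
  rw [hlim]
  refine tendsto_integral_filter_of_dominated_convergence (fun z => M * φ z) ?_ ?_
    (hφ.integrable.const_mul M) ?_
  · refine Eventually.of_forall fun ε => Measurable.aestronglyMeasurable ?_
    exact ((measurable_indicator_Ioc hF).comp (by fun_prop)).mul hφ.1.measurable
  · refine Eventually.of_forall fun ε => Eventually.of_forall fun z => ?_
    rw [norm_mul, norm_eq_abs, norm_eq_abs, abs_of_nonneg (hφ.2.1 z)]
    exact mul_le_mul_of_nonneg_right (hM _) (hφ.2.1 z)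
  · filter_upwards [Measure.ae_ne volume y] with z hz
    have h := (tendsto_indicator_Ioc_ray hF a (sub_ne_zero.2 hz.symm)).mul_const (φ z)
    convert h using 2
    rcases hz.lt_or_gt with hz | hz
    · simp [hz.le, hz, hab]
    · simp [hz, hz.not_gt]

/-- Lemma 5.2: a regularized nonconservative product.
As `ε → 0+`,
`I^ε = ∫_{a'}^{b'} ψ(s₁) f(s₁) φ₂^ε(s₁−a) (∫_a^b F(s₃) φ₃^ε(s₁−s₃) ds₃) ds₁`
converges to `ψ(a) F(a) (A⁻ f(a) 1_{a'<a<b'} + B⁻ f(a') 1_{a=a'} + C⁻ f(b') 1_{a=b'})`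
with `A⁻ = B⁻ + C⁻` depending only on the mollifiers. -/
theorem nonconservative_product_limit_minus
    (ψ F : ℝ → ℝ) (hψ : Continuous ψ) (hF : Continuous F)
    (a' b' : ℝ) (ha'b' : a' < b')
    (f : ℝ → ℝ) (hf : ContinuousOn f (Set.Icc a' b'))
    (a b : ℝ) (hab : a < b)
    (φ₂ φ₃ : ℝ → ℝ) (h₂ : IsMollifier φ₂) (h₃ : IsMollifier φ₃) :
    Tendsto (fun ε : ℝ =>
        ∫ s₁ in a'..b', ψ s₁ * f s₁ * (ε⁻¹ * φ₂ ((s₁ - a) / ε)) *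
          ∫ s₃ in a..b, F s₃ * (ε⁻¹ * φ₃ ((s₁ - s₃) / ε)))
      (𝓝[>] 0)
      (𝓝 (ψ a * F a *
        ((Bminus φ₂ φ₃ + Cminus φ₂ φ₃) * f a * (if a' < a ∧ a < b' then 1 else 0)
          + Bminus φ₂ φ₃ * f a' * (if a = a' then 1 else 0)
          + Cminus φ₂ φ₃ * f b' * (if a = b' then 1 else 0)))) := by
  have hg : ContinuousOn (fun s => ψ s * f s) (Icc a' b') := hψ.continuousOn.mul hf
  set g : ℝ → ℝ := fun s => ψ s * f s with hgdef
  obtain ⟨M, hM⟩ := exists_abs_indicator_Ioc_le hg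
  obtain ⟨N, hN⟩ := exists_abs_indicator_Ioc_le (hF.continuousOn (s := Icc a b))
  set u : ℝ := if a' ≤ a ∧ a < b' then g a else 0 with hu
  set v : ℝ := if a' < a ∧ a ≤ b' then g a else 0 with hv
  set Φ : ℝ → ℝ := fun y => ∫ z in Iic y, φ₃ z with hΦ
  have hΦm : Measurable Φ := (monotone_setIntegral_Iic h₃.integrable h₃.2.1).measurable
  have hΦ0 : ∀ y, 0 ≤ Φ y := fun y => integral_nonneg h₃.2.1
  have hΦ1 : ∀ y, Φ y ≤ 1 := fun y => by
    rw [← h₃.2.2.2]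
    exact setIntegral_le_integral h₃.integrable (Eventually.of_forall h₃.2.1)
  have hprod : Integrable fun y => φ₂ y * Φ y :=
    h₂.integrable.mul_bdd (c := 1) hΦm.aestronglyMeasurable
      (Eventually.of_forall fun y => by
        rw [norm_eq_abs, abs_of_nonneg (hΦ0 y)]; exact hΦ1 y)
  have hB : Bminus φ₂ φ₃ = ∫ y in Ioi 0, φ₂ y * Φ y := by
    simp only [Bminus, integral_const_mul, hΦ]
  have hC : Cminus φ₂ φ₃ = ∫ y in Iio 0, φ₂ y * Φ y := by
    simp only [Cminus, integral_const_mul, hΦ]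
  have hval : ψ a * F a *
        ((Bminus φ₂ φ₃ + Cminus φ₂ φ₃) * f a * (if a' < a ∧ a < b' then 1 else 0)
          + Bminus φ₂ φ₃ * f a' * (if a = a' then 1 else 0)
          + Cminus φ₂ φ₃ * f b' * (if a = b' then 1 else 0)) =
      F a * (u * Bminus φ₂ φ₃ + v * Cminus φ₂ φ₃) := by
    rcases lt_trichotomy a a' with h | h | h
    · simp [hu, hv, h.not_ge, h.not_gt, h.ne, (h.trans ha'b').ne]
    · subst h
      simp [hu, hv, ha'b', ha'b'.ne, hgdef]
      ring
    · rcases lt_trichotomy a b' with h' | h' | h'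
      · simp [hu, hv, h, h.le, h', h'.le, h.ne', h'.ne, hgdef]
        ring
      · subst h'
        simp [hu, hv, h, h.ne', hgdef]
        ring
      · simp [hu, hv, h'.not_ge, h'.not_gt, h.ne', h'.ne']
  have hlim : F a * (u * Bminus φ₂ φ₃ + v * Cminus φ₂ φ₃) =
      ∫ y, (Ioi 0).indicator (fun y => F a * u * (φ₂ y * Φ y)) y +
        (Iio 0).indicator (fun y => F a * v * (φ₂ y * Φ y)) y := by
    rw [integral_add ((hprod.const_mul _).indicator measurableSet_Ioi)
      ((hprod.const_mul _).indicator measurableSet_Iio), integral_indicator measurableSet_Ioi,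
      integral_indicator measurableSet_Iio, integral_const_mul, integral_const_mul, ← hB, ← hC]
    ring
  rw [hval, hlim]
  have hresc : ∀ ε : ℝ, 0 < ε →
      ∫ y, (Ioc a' b').indicator g (a + ε * y) * φ₂ y *
        (∫ s in a..b, F s * (ε⁻¹ * φ₃ ((a + ε * y - s) / ε))) =
      ∫ s₁ in a'..b', ψ s₁ * f s₁ * (ε⁻¹ * φ₂ ((s₁ - a) / ε)) *
          ∫ s₃ in a..b, F s₃ * (ε⁻¹ * φ₃ ((s₁ - s₃) / ε)) := by
    intro ε hε
    have key := integral_comp_add_mul (fun s => (Ioc a' b').indicator g s * φ₂ ((s - a) / ε) *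
        (∫ s₃ in a..b, F s₃ * (ε⁻¹ * φ₃ ((s - s₃) / ε)))) a ε
    rw [abs_inv, abs_of_pos hε, ← integral_const_mul] at key
    rw [intervalIntegral.integral_of_le ha'b'.le, ← integral_indicator measurableSet_Ioc]
    convert key using 1
    · congr 1 with y
      rw [add_sub_cancel_left, mul_div_cancel_left₀ _ hε.ne']
    · congr 1 with s
      by_cases hs : s ∈ Ioc a' b'
      · simp only [indicator_of_mem hs, hgdef]; ring
      · simp only [indicator_of_notMem hs]; ring
  have hpos : ∀ᶠ ε : ℝ in 𝓝[>] 0, 0 < ε := self_mem_nhdsWithin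
  refine Tendsto.congr' (hpos.mono hresc) ?_
  refine tendsto_integral_filter_of_dominated_convergence (fun y => M * φ₂ y * N) ?_ ?_
    ((h₂.integrable.const_mul M).mul_const N) ?_
  · refine Eventually.of_forall fun ε => Measurable.aestronglyMeasurable ?_
    refine (((measurable_indicator_Ioc hg).comp (by fun_prop)).mul h₂.1.measurable).mul
      (Continuous.measurable ?_)
    have := h₃.1
    exact intervalIntegral.continuous_parametric_intervalIntegral_of_continuous' (by fun_prop) a b
  · filter_upwards [hpos] with ε hε
    refine Eventually.of_forall fun y => ?_
    rw [intervalIntegral_mollifier_eq F φ₃ hab.le hε, norm_mul, norm_mul, norm_eq_abs,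
      norm_eq_abs, norm_eq_abs, abs_of_nonneg (h₂.2.1 y)]
    have hM0 : 0 ≤ M := (abs_nonneg _).trans (hM 0)
    exact mul_le_mul (mul_le_mul_of_nonneg_right (hM _) (h₂.2.1 y))
      (abs_integral_indicator_mul_le h₃ hN ε y) (abs_nonneg _) (mul_nonneg hM0 (h₂.2.1 y))
  · filter_upwards [Measure.ae_ne volume (0 : ℝ)] with y hy
    have h := ((tendsto_indicator_Ioc_ray hg a hy).mul_const (φ₂ y)).mul
      (tendsto_integral_indicator_mul hab hF.continuousOn h₃ y)
    have h' := h.congr' (hpos.mono fun ε hε => by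
      rw [← intervalIntegral_mollifier_eq F φ₃ hab.le hε])
    convert h' using 2
    rcases hy.lt_or_gt with hy | hy
    · simp only [mem_Ioi, mem_Iio, hy, hy.not_gt, not_false_eq_true, indicator_of_notMem,
        indicator_of_mem, if_false, zero_add, ← hv]
      ring
    · simp only [mem_Ioi, mem_Iio, hy, hy.not_gt, not_false_eq_true, indicator_of_notMem,
        indicator_of_mem, if_true, add_zero, ← hu]
      ring
end
end

section
/- Let A = 1/4 and let f : ℝ → ℝ be a C² function solving the ordinary differential equation x f''(x) + f'(x) + A² f(x) = 0 for all x ∈ ℝ. Then the function η(ρ, u) := ρ^{1/2} f(u² − (ln ρ)²), defined for ρ > 0 and u ∈ ℝ, satisfies the entropy equation of the isothermal Euler system: ∂²η/∂ρ² (ρ,u) = ρ^{−2} ∂²η/∂u² (ρ,u) for all ρ > 0 and u ∈ ℝ. -/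
open MeasureTheory Real Set Filter Topology

noncomputable section

/-- Away from `0`, on the positive axis, `√` solves `r y' = y / 2`. -/
lemma hasDerivAt_sqrt_of_pos {r : ℝ} (hr : 0 < r) :
    HasDerivAt Real.sqrt (√r / (2 * r)) r := by
  refine (Real.hasDerivAt_sqrt hr.ne').congr_deriv ?_
  have hs : √r ≠ 0 := (Real.sqrt_pos.mpr hr).ne'
  field_simp
  exact (Real.sq_sqrt hr.le).symm

/-- Chain rule for `r ↦ g (c - (log r)²)`. -/
lemma hasDerivAt_comp_sub_log_sq {g : ℝ → ℝ} (hg : Differentiable ℝ g) (c : ℝ) {r : ℝ}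
    (hr : 0 < r) :
    HasDerivAt (fun r => g (c - Real.log r ^ 2))
      (deriv g (c - Real.log r ^ 2) * (-(2 * Real.log r / r))) r := by
  refine (hg _).hasDerivAt.comp r ?_
  refine (((Real.hasDerivAt_log hr.ne').pow 2).const_sub c).congr_deriv ?_
  simp [div_eq_mul_inv, mul_assoc]

/-- Chain rule for `v ↦ g (v² - c)`. -/
lemma hasDerivAt_comp_sq_sub {g : ℝ → ℝ} (hg : Differentiable ℝ g) (c v : ℝ) :
    HasDerivAt (fun v => g (v ^ 2 - c)) (deriv g (v ^ 2 - c) * (2 * v)) v := by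
  refine (hg _).hasDerivAt.comp v ?_
  refine (((hasDerivAt_id v).pow 2).sub_const c).congr_deriv ?_
  simp

/-- If `f` is a `C²` solution of `x f'' + f' + A² f = 0`
with `A = 1/4`, then the invariant function `η(ρ,u) = ρ^{1/2} f(u² − (ln ρ)²)`
satisfies the entropy equation `η_ρρ = ρ^{−2} η_uu` of the isothermal Euler
system, for all `ρ > 0` and `u ∈ ℝ`. -/
theorem invariant_solution_entropy_equation
    (f : ℝ → ℝ) (hf : ContDiff ℝ 2 f)
    (hode : ∀ x : ℝ,
      x * deriv (deriv f) x + deriv f x + ((1 : ℝ) / 4) ^ 2 * f x = 0) :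
    ∀ ρ u : ℝ, 0 < ρ →
      deriv (fun r => deriv
          (fun r' => Real.sqrt r' * f (u ^ 2 - Real.log r' ^ 2)) r) ρ
        = (1 / ρ ^ 2) * deriv (fun v => deriv
            (fun v' => Real.sqrt ρ * f (v' ^ 2 - Real.log ρ ^ 2)) v) u := by
  intro ρ u hρ
  have hf0 : Differentiable ℝ f := hf.differentiable (by norm_num)
  have hf1 : Differentiable ℝ (deriv f) :=
    ((contDiff_succ_iff_deriv (n := 1)).mp hf).2.2.differentiable (by norm_num)
  have hρ1 : (fun r => deriv (fun r' => Real.sqrt r' * f (u ^ 2 - Real.log r' ^ 2)) r) =ᶠ[𝓝 ρ]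
      fun r => √r * r⁻¹ * (f (u ^ 2 - Real.log r ^ 2) / 2
        - 2 * (Real.log r * deriv f (u ^ 2 - Real.log r ^ 2))) := by
    filter_upwards [lt_mem_nhds hρ] with r hr
    refine ((hasDerivAt_sqrt_of_pos hr).mul (hasDerivAt_comp_sub_log_sq hf0 (u ^ 2) hr)).deriv.trans
      ?_
    field_simp
    ring
  have hu1 : (fun v => deriv (fun v' => Real.sqrt ρ * f (v' ^ 2 - Real.log ρ ^ 2)) v) =
      fun v => √ρ * (deriv f (v ^ 2 - Real.log ρ ^ 2) * (2 * v)) :=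
    funext fun v => ((hasDerivAt_comp_sq_sub hf0 _ v).const_mul _).deriv
  have hρ2 := ((hasDerivAt_sqrt_of_pos hρ).mul (hasDerivAt_inv hρ.ne')).mul
    (((hasDerivAt_comp_sub_log_sq hf0 (u ^ 2) hρ).div_const 2).sub
      (((Real.hasDerivAt_log hρ.ne').mul
        (hasDerivAt_comp_sub_log_sq hf1 (u ^ 2) hρ)).const_mul 2))
  have hu2 := ((hasDerivAt_comp_sq_sub hf1 (Real.log ρ ^ 2) u).mul
    ((hasDerivAt_id u).const_mul 2)).const_mul √ρ
  rw [hρ1.deriv_eq, hu1]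
  refine hρ2.deriv.trans (Eq.trans ?_ (congrArg (1 / ρ ^ 2 * ·) hu2.deriv.symm))
  have h := hode (u ^ 2 - Real.log ρ ^ 2)
  simp only [Pi.mul_apply, Pi.sub_apply, id]
  field_simp
  linear_combination (-16) * h
end
end
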